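/- arXiv:math/0506282 — 3 statements merged into one kernel-verified Lean document; each statement's English description precedes it below -/
import Mathlib

section
/- Let D ⊂ ℂ be a bounded domain whose boundary bD is the image of a map γ : ℝ → ℂ that is real-analytic, 2π-periodic, injective on [0, 2π), with γ′(s) ≠ 0 for all s. Let t ∈ ℝ be such that Re(γ′(s)) ≠ 0 for every s with Re(γ(s)) = t, and suppose the set K(t) = {y ∈ ℝ : t + iy ∈ D̄} is nonempty. Then K(t) is a finite union of pairwise disjoint compact intervals [y₁, y₂] with y₁ < y₂, such that for each such interval t + iy₁ ∈ bD, t + iy₂ ∈ bD, and t + iy ∈ D for all y with y₁ < y < y₂. -/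
open Complex Set

/-- A map of period `2π` that is injective on `[0, 2π)` takes each value at most once on
a closed interval of radius `π` centred at a point with that value. -/
lemma eq_of_abs_sub_le_pi {γ : ℝ → ℂ} (hper : ∀ s : ℝ, γ (s + 2 * Real.pi) = γ s)
    (hinj : InjOn γ (Ico 0 (2 * Real.pi))) {s s₀ : ℝ} (hs : |s - s₀| ≤ Real.pi)
    (h : γ s = γ s₀) : s = s₀ := by
  have hp : Function.Periodic γ (2 * Real.pi) := hper
  have hred : ∀ x, γ (toIcoMod Real.two_pi_pos 0 x) = γ x := fun x => hp.sub_zsmul_eq _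
  have hmem : ∀ x, toIcoMod Real.two_pi_pos 0 x ∈ Ico 0 (2 * Real.pi) := fun x => by
    simpa using toIcoMod_mem_Ico Real.two_pi_pos 0 x
  have heq := hinj (hmem s) (hmem s₀) (by rw [hred, hred, h])
  obtain ⟨n, hn⟩ := (toIcoMod_eq_toIcoMod Real.two_pi_pos).1 heq
  rw [zsmul_eq_mul] at hn
  have hπ := Real.pi_pos
  rw [abs_le] at hs
  have hn0 : n = 0 := by
    have h1 : (n : ℝ) < 1 := by nlinarith
    have h2 : (-1 : ℝ) < n := by nlinarith
    have h1' : n < 1 := by exact_mod_cast h1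
    have h2' : -1 < n := by exact_mod_cast h2
    omega
  subst hn0
  simp at hn
  linarith

/-- The sweep of a curve in a direction transverse to it is a local homeomorphism. -/
lemma exists_openPartialHomeomorph_sweep {γ : ℝ → ℂ} {v c : ℂ} {s₀ : ℝ}
    (hγ : HasStrictDerivAt γ v s₀) (hv : v.re * c.im - v.im * c.re ≠ 0) :
    ∃ e : OpenPartialHomeomorph (ℝ × ℝ) ℂ, (s₀, 0) ∈ e.source ∧
      ∀ p, e p = γ p.1 + p.2 * c := by
  let L : ℝ × ℝ →L[ℝ] ℂ := (ContinuousLinearMap.fst ℝ ℝ ℝ).smulRight v +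
    (ContinuousLinearMap.snd ℝ ℝ ℝ).smulRight c
  have hinj : Function.Injective (L : ℝ × ℝ →ₗ[ℝ] ℂ) := by
    rw [← LinearMap.ker_eq_bot, LinearMap.ker_eq_bot']
    rintro ⟨a, b⟩ hab
    have hab' : (a : ℂ) * v + b * c = 0 := by simpa [L] using hab
    have hre := congrArg Complex.re hab'
    have him := congrArg Complex.im hab'
    simp at hre him
    have ha : a * (v.re * c.im - v.im * c.re) = 0 := by linear_combination c.im * hre - c.re * him
    have hb : b * (v.re * c.im - v.im * c.re) = 0 := by linear_combination v.re * him - v.im * hre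
    simp only [mul_eq_zero, hv, or_false] at ha hb
    simp [ha, hb]
  let M : (ℝ × ℝ) ≃L[ℝ] ℂ :=
    (LinearEquiv.ofInjectiveOfFinrankEq (L : ℝ × ℝ →ₗ[ℝ] ℂ) hinj
      (by simp [Complex.finrank_real_complex])).toContinuousLinearEquiv
  have hM : (M : ℝ × ℝ →L[ℝ] ℂ) = L := by
    exact ContinuousLinearMap.ext fun _ => rfl
  have hΦ : HasStrictFDerivAt (fun p : ℝ × ℝ => γ p.1 + p.2 * c) (M : ℝ × ℝ →L[ℝ] ℂ) (s₀, 0) := by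
    rw [hM]
    have h1 : HasStrictFDerivAt (fun p : ℝ × ℝ => γ p.1)
        ((ContinuousLinearMap.fst ℝ ℝ ℝ).smulRight v) (s₀, 0) :=
      (hγ.hasStrictFDerivAt.comp ((s₀, 0) : ℝ × ℝ) hasStrictFDerivAt_fst).congr_fderiv
        (by ext <;> simp)
    have h2 : HasStrictFDerivAt (fun p : ℝ × ℝ => (p.2 : ℂ) * c)
        ((ContinuousLinearMap.snd ℝ ℝ ℝ).smulRight c) (s₀, 0) := by
      exact ((ContinuousLinearMap.snd ℝ ℝ ℝ).smulRight c).hasStrictFDerivAt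
    exact h1.add h2
  exact ⟨hΦ.toOpenPartialHomeomorph _, hΦ.mem_toOpenPartialHomeomorph_source, fun _ => rfl⟩

/-- Near each of its points, a simple closed curve misses its small nonzero translates in a
transverse direction, and these translates together with the curve fill a neighbourhood. -/
lemma exists_transverse_box {γ : ℝ → ℂ} (hcont : Continuous γ)
    (hper : ∀ s : ℝ, γ (s + 2 * Real.pi) = γ s) (hinj : InjOn γ (Ico 0 (2 * Real.pi)))
    {v c : ℂ} {s₀ : ℝ} (hγ : HasStrictDerivAt γ v s₀) (hv : v.re * c.im - v.im * c.re ≠ 0) :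
    ∃ δ > 0, (∀ s ∈ Ioo (s₀ - δ) (s₀ + δ), ∀ u ∈ Ioo (-δ) δ, u ≠ 0 → γ s + u * c ∉ range γ) ∧
      ∀ᶠ z in nhds (γ s₀), ∃ s ∈ Ioo (s₀ - δ) (s₀ + δ), ∃ u ∈ Ioo (-δ) δ,
        z = γ s + u * c := by
  obtain ⟨e, he, heq⟩ := exists_openPartialHomeomorph_sweep hγ hv
  obtain ⟨ρ, hρ, hball⟩ := Metric.mem_nhds_iff.1 (e.open_source.mem_nhds he)
  have hsub : ∀ s ∈ Ioo (s₀ - ρ) (s₀ + ρ), ∀ u ∈ Ioo (-ρ) ρ, (s, u) ∈ e.source := by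
    intro s hs u hu
    apply hball
    rw [← ball_prod_same, Real.ball_eq_Ioo, Real.ball_eq_Ioo]
    exact ⟨hs, by simpa using hu⟩
  let C := γ '' (Icc (s₀ - Real.pi) (s₀ + Real.pi) \ Ioo (s₀ - ρ) (s₀ + ρ))
  have hC : IsClosed C := ((isCompact_Icc.diff isOpen_Ioo).image hcont).isClosed
  have hpC : γ s₀ ∉ C := by
    rintro ⟨s, ⟨hs, hs'⟩, h⟩
    have := eq_of_abs_sub_le_pi hper hinj (abs_le.2 ⟨by linarith [hs.1], by linarith [hs.2]⟩) h
    subst this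
    exact hs' ⟨by linarith, by linarith⟩
  have hΦc : Continuous fun p : ℝ × ℝ => γ p.1 + p.2 * c := by fun_prop
  have hev : ∀ᶠ p : ℝ × ℝ in nhds (s₀, 0), γ p.1 + p.2 * c ∉ C :=
    hΦc.continuousAt.eventually (hC.isOpen_compl.mem_nhds (by simpa using hpC))
  obtain ⟨η, hη, hηC⟩ := Metric.eventually_nhds_iff_ball.1 hev
  refine ⟨min ρ η, lt_min hρ hη, ?_, ?_⟩
  · rintro s hs u hu hu0 ⟨s', hs'⟩
    have hlρ := min_le_left ρ η
    have hlη := min_le_right ρ η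
    have hs1 : s ∈ Ioo (s₀ - ρ) (s₀ + ρ) := ⟨by linarith [hs.1], by linarith [hs.2]⟩
    have hu1 : u ∈ Ioo (-ρ) ρ := ⟨by linarith [hu.1], by linarith [hu.2]⟩
    have hnC : γ s + u * c ∉ C := by
      refine hηC (s, u) ?_
      rw [← ball_prod_same, Real.ball_eq_Ioo, Real.ball_eq_Ioo]
      exact ⟨⟨by linarith [hs.1], by linarith [hs.2]⟩, ⟨by linarith [hu.1], by linarith [hu.2]⟩⟩
    have hp : Function.Periodic γ (2 * Real.pi) := hper
    obtain ⟨r, hr, hr'⟩ : ∃ r ∈ Icc (s₀ - Real.pi) (s₀ + Real.pi), γ r = γ s' := by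
      obtain ⟨r, hr, h⟩ := hp.exists_mem_Ico Real.two_pi_pos s' (s₀ - Real.pi)
      exact ⟨r, ⟨hr.1, by linarith [hr.2]⟩, h.symm⟩
    have hrρ : r ∈ Ioo (s₀ - ρ) (s₀ + ρ) := by
      by_contra hr0
      exact hnC ⟨r, ⟨hr, hr0⟩, hr'.trans hs'⟩
    have := e.injOn (hsub s hs1 u hu1) (hsub r hrρ 0 ⟨by linarith, hρ⟩)
      (by rw [heq, heq]; simp [hr', hs'])
    exact hu0 (Prod.ext_iff.1 this).2
  · have hδ : 0 < min ρ η := lt_min hρ hη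
    have hn := e.map_nhds_eq he
    have hes : e (s₀, 0) = γ s₀ := by simp [heq]
    rw [hes] at hn
    rw [← hn, Filter.eventually_map]
    filter_upwards [Metric.ball_mem_nhds (s₀, (0 : ℝ)) hδ] with p hp
    rw [← ball_prod_same, Real.ball_eq_Ioo, Real.ball_eq_Ioo] at hp
    exact ⟨p.1, hp.1, p.2, by simpa using hp.2, heq p⟩

/-- A preconnected set that misses the boundary of an open set lies on one side of it. -/
lemma IsPreconnected.subset_or_subset_compl_closure {D S : Set ℂ} (hS : IsPreconnected S)
    (hD : IsOpen D) (h : Disjoint S (frontier D)) : S ⊆ D ∨ S ⊆ (closure D)ᶜ := by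
  refine isPreconnected_iff_subset_of_disjoint.1 hS D (closure D)ᶜ hD
    isClosed_closure.isOpen_compl ?_ ?_
  · intro x hx
    by_cases hxD : x ∈ D
    · exact Or.inl hxD
    · refine Or.inr fun hxc => disjoint_left.1 h hx ?_
      rw [hD.frontier_eq]
      exact ⟨hxc, hxD⟩
  · rw [((disjoint_compl_right).mono_left subset_closure).inter_eq, inter_empty]

/-- If a simple closed curve bounds `D`, then near each of its points every one of `D` and the
exterior of `D` that accumulates there contains a full one-sided transverse strip. -/
lemma exists_transverse_strip {D : Set ℂ} (hD : IsOpen D) {γ : ℝ → ℂ} (hcont : Continuous γ)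
    (hper : ∀ s : ℝ, γ (s + 2 * Real.pi) = γ s) (hinj : InjOn γ (Ico 0 (2 * Real.pi)))
    (hrange : range γ = frontier D)
    {v c : ℂ} {s₀ : ℝ} (hγ : HasStrictDerivAt γ v s₀) (hv : v.re * c.im - v.im * c.re ≠ 0) :
    ∃ δ > 0, ∀ W, (W = D ∨ W = (closure D)ᶜ) → γ s₀ ∈ closure W →
      (∀ s ∈ Ioo (s₀ - δ) (s₀ + δ), ∀ u ∈ Ioo 0 δ, γ s + u * c ∈ W) ∨
      (∀ s ∈ Ioo (s₀ - δ) (s₀ + δ), ∀ u ∈ Ioo (-δ) 0, γ s + u * c ∈ W) := by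
  obtain ⟨δ, hδ, hmiss, hfill⟩ := exists_transverse_box hcont hper hinj hγ hv
  refine ⟨δ, hδ, fun W hW hmem => ?_⟩
  have hdisj : Disjoint W (range γ) := by
    rw [hrange]
    rcases hW with rfl | rfl
    · exact (disjoint_frontier_iff_isOpen.2 hD).symm
    · exact disjoint_compl_left.mono_right frontier_subset_closure
  have hcover : ∀ S : Set ℂ, IsPreconnected S → Disjoint S (frontier D) → (S ∩ W).Nonempty →
      S ⊆ W := by
    rintro S hS hSD ⟨z, hzS, hzW⟩
    rcases hS.subset_or_subset_compl_closure hD hSD with h | h <;> rcases hW with rfl | rfl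
    · exact h
    · exact absurd (subset_closure (h hzS)) hzW
    · exact absurd (subset_closure hzW) (h hzS)
    · exact h
  have hstrip : ∀ I : Set ℝ, IsPreconnected I → I ⊆ Ioo (-δ) δ → (0 : ℝ) ∉ I →
      (∃ s ∈ Ioo (s₀ - δ) (s₀ + δ), ∃ u ∈ I, γ s + u * c ∈ W) →
      ∀ s ∈ Ioo (s₀ - δ) (s₀ + δ), ∀ u ∈ I, γ s + u * c ∈ W := by
    rintro I hI hIδ hI0 ⟨s₁, hs₁, u₁, hu₁, hW₁⟩ s hs u hu
    have hΦc : Continuous fun p : ℝ × ℝ => γ p.1 + p.2 * c := by fun_prop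
    refine hcover ((fun p : ℝ × ℝ => γ p.1 + p.2 * c) '' (Ioo (s₀ - δ) (s₀ + δ) ×ˢ I))
      ((isPreconnected_Ioo.prod hI).image _ hΦc.continuousOn) ?_
      ⟨_, ⟨(s₁, u₁), ⟨hs₁, hu₁⟩, rfl⟩, hW₁⟩ ⟨(s, u), ⟨hs, hu⟩, rfl⟩
    rw [disjoint_left, ← hrange]
    rintro _ ⟨p, hp, rfl⟩
    exact hmiss p.1 hp.1 p.2 (hIδ hp.2) fun h => hI0 (h ▸ hp.2)
  obtain ⟨_, hzW, s, hs, u, hu, rfl⟩ :=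
    ((mem_closure_iff_frequently.1 hmem).and_eventually hfill).exists
  have hu0 : u ≠ 0 := by
    rintro rfl
    exact disjoint_left.1 hdisj hzW ⟨s, by simp⟩
  rcases lt_or_gt_of_ne hu0 with h | h
  · exact Or.inr (hstrip _ isPreconnected_Ioo (Ioo_subset_Ioo_right hδ.le) (by simp)
      ⟨s, hs, u, ⟨hu.1, h⟩, hzW⟩)
  · exact Or.inl (hstrip _ isPreconnected_Ioo (Ioo_subset_Ioo_left (by linarith)) (by simp)
      ⟨s, hs, u, ⟨h, hu.2⟩, hzW⟩)

/-- A bounded nonempty open set with a smooth simple closed boundary curve has every boundary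
point in the closure of its exterior. -/
lemma frontier_subset_closure_exterior {D : Set ℂ} (hD : IsOpen D) (hne : D.Nonempty)
    (hbdd : Bornology.IsBounded D) {γ : ℝ → ℂ}
    (hder : ∀ s, HasStrictDerivAt γ (deriv γ s) s) (hγ' : ∀ s, deriv γ s ≠ 0)
    (hper : ∀ s : ℝ, γ (s + 2 * Real.pi) = γ s) (hinj : InjOn γ (Ico 0 (2 * Real.pi)))
    (hrange : range γ = frontier D) : frontier D ⊆ closure (closure D)ᶜ := by
  have hcont : Continuous γ := continuous_iff_continuousAt.2 fun s => (hder s).hasDerivAt.continuousAt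
  have hclosed : IsClosed (γ ⁻¹' closure (closure D)ᶜ) := isClosed_closure.preimage hcont
  have hopen : IsOpen (γ ⁻¹' closure (closure D)ᶜ) := by
    rw [isOpen_iff_mem_nhds]
    intro s₀ hs₀
    have hv : (deriv γ s₀).re * (I * deriv γ s₀).im - (deriv γ s₀).im * (I * deriv γ s₀).re ≠ 0 := by
      have h := normSq_pos.2 (hγ' s₀)
      rw [normSq_apply] at h
      simp only [I_mul_im, I_mul_re]
      linarith
    obtain ⟨δ, hδ, h⟩ := exists_transverse_strip hD hcont hper hinj hrange (hder s₀) hv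
    filter_upwards [Ioo_mem_nhds (by linarith : s₀ - δ < s₀) (by linarith : s₀ < s₀ + δ)] with s hs
    have hlim : Filter.Tendsto (fun u : ℝ => γ s + u * (I * deriv γ s₀)) (nhds 0) (nhds (γ s)) := by
      have : Continuous fun u : ℝ => γ s + u * (I * deriv γ s₀) := by fun_prop
      simpa using this.tendsto 0
    rcases h _ (Or.inr rfl) hs₀ with h | h
    · exact mem_closure_of_tendsto (hlim.mono_left nhdsWithin_le_nhds)
        (Filter.eventually_of_mem (Ioo_mem_nhdsGT hδ) (h s hs))
    · exact mem_closure_of_tendsto (hlim.mono_left nhdsWithin_le_nhds)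
        (Filter.eventually_of_mem (Ioo_mem_nhdsLT (neg_lt_zero.2 hδ)) (h s hs))
  rcases isClopen_iff.1 ⟨hclosed, hopen⟩ with h | h
  · exfalso
    have hE : frontier (closure D) = ∅ := by
      rw [eq_empty_iff_forall_notMem]
      intro z hz
      obtain ⟨s, rfl⟩ : z ∈ range γ := hrange ▸ frontier_closure_subset hz
      rw [← frontier_compl] at hz
      exact eq_empty_iff_forall_notMem.1 h s (frontier_subset_closure hz)
    rcases isClopen_iff.1 (isClopen_iff_frontier_eq_empty.2 hE) with h | h
    · exact hne.ne_empty (closure_empty_iff _ |>.1 h)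
    · exact NormedSpace.unbounded_univ ℝ ℂ (h ▸ hbdd.closure)
  · rw [← hrange]
    rintro _ ⟨s, rfl⟩
    exact h.ge (mem_univ s)

/-- If disjoint open sets `U`, `V` of reals lie on opposite sides of each point outside `U ∪ V`
and the complement of `V` is bounded, then this complement is a finite disjoint union of
nondegenerate compact intervals with interiors in `U` and endpoints outside `U ∪ V`. -/
lemma exists_finite_Icc_decomposition {U V : Set ℝ} (hU : IsOpen U) (hV : IsOpen V)
    (hUV : Disjoint U V) (hbdd : Bornology.IsBounded Vᶜ) (hne : Vᶜ.Nonempty)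
    (hside : ∀ b, b ∉ U → b ∉ V → ∃ ε > 0,
      (Ioo (b - ε) b ⊆ U ∧ Ioo b (b + ε) ⊆ V) ∨ (Ioo (b - ε) b ⊆ V ∧ Ioo b (b + ε) ⊆ U)) :
    ∃ (m : ℕ) (y₁ y₂ : Fin m → ℝ), 0 < m ∧ (∀ i, y₁ i < y₂ i) ∧
      Vᶜ = ⋃ i, Icc (y₁ i) (y₂ i) ∧
      (Pairwise fun i j => Disjoint (Icc (y₁ i) (y₂ i)) (Icc (y₁ j) (y₂ j))) ∧
      (∀ i, y₁ i ∈ Vᶜ \ U) ∧ (∀ i, y₂ i ∈ Vᶜ \ U) ∧ ∀ i, Ioo (y₁ i) (y₂ i) ⊆ U := by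
  set B := Vᶜ \ U with hB
  have hBfin : B.Finite := by
    by_contra hinf
    have hBc : IsCompact B := Metric.isCompact_of_isClosed_isBounded
      (hV.isClosed_compl.sdiff hU) (hbdd.subset sdiff_subset)
    obtain ⟨b, hb, hacc⟩ := Set.Infinite.exists_accPt_of_subset_isCompact hinf hBc subset_rfl
    obtain ⟨ε, hε, h⟩ := hside b hb.2 hb.1
    obtain ⟨y, ⟨hy, hyB⟩, hyb⟩ := accPt_iff_nhds.1 hacc (Ioo (b - ε) (b + ε))
      (Ioo_mem_nhds (by linarith) (by linarith))
    rcases lt_or_gt_of_ne hyb with hlt | hgt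
    · rcases h with h | h
      · exact hyB.2 (h.1 ⟨hy.1, hlt⟩)
      · exact hyB.1 (h.1 ⟨hy.1, hlt⟩)
    · rcases h with h | h
      · exact hyB.1 (h.2 ⟨hgt, hy.2⟩)
      · exact hyB.2 (h.2 ⟨hgt, hy.2⟩)
  have hconn : ∀ S : Set ℝ, IsPreconnected S → (∀ b ∈ B, b ∉ S) → (S ∩ U).Nonempty → S ⊆ U := by
    rintro S hS hSB ⟨z, hzS, hzU⟩
    refine (isPreconnected_iff_subset_of_disjoint.1 hS U V hU hV (fun x hx => ?_)
      (by rw [hUV.inter_eq, inter_empty])).resolve_right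
      fun h => disjoint_left.1 hUV hzU (h hzS)
    by_contra hx'
    rw [mem_union, not_or] at hx'
    exact hSB x ⟨hx'.2, hx'.1⟩ hx
  have hUb : U ⊆ Vᶜ := hUV.subset_compl_right
  have hbound : ∀ y ∈ U, ∃ a ∈ B, ∃ b ∈ B, a < y ∧ y < b ∧ Ioo a b ⊆ U := by
    intro y hy
    have hup : (B ∩ Ici y).Nonempty := by
      by_contra hempty
      have h := hconn (Ici y) isPreconnected_Ici (fun b hb hby => hempty ⟨b, hb, hby⟩)
        ⟨y, self_mem_Ici, hy⟩
      exact not_bddAbove_Ici y (hbdd.subset (h.trans hUb)).bddAbove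
    have hdown : (B ∩ Iic y).Nonempty := by
      by_contra hempty
      have h := hconn (Iic y) isPreconnected_Iic (fun b hb hby => hempty ⟨b, hb, hby⟩)
        ⟨y, self_mem_Iic, hy⟩
      exact not_bddBelow_Iic y (hbdd.subset (h.trans hUb)).bddBelow
    obtain ⟨b, ⟨hbB, hyb⟩, hbmin⟩ := exists_min_image _ id (hBfin.inter_of_left _) hup
    obtain ⟨a, ⟨haB, hay⟩, hamax⟩ := exists_max_image _ id (hBfin.inter_of_left _) hdown
    have hyb' : y < b := lt_of_le_of_ne hyb (by rintro rfl; exact hbB.2 hy)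
    have hay' : a < y := lt_of_le_of_ne hay (by rintro rfl; exact haB.2 hy)
    refine ⟨a, haB, b, hbB, hay', hyb', hconn _ isPreconnected_Ioo ?_ ⟨y, ⟨hay', hyb'⟩, hy⟩⟩
    rintro x hx ⟨hax, hxb⟩
    rcases le_total x y with h | h
    · exact absurd (hamax x ⟨hx, h⟩) (not_le.2 hax)
    · exact absurd (hbmin x ⟨hx, h⟩) (not_le.2 hxb)
  have htouch : ∀ a b d, a < b → b < d → b ∈ B → Ioo a b ⊆ U → Ioo b d ⊆ U → False := by
    intro a b d hab hbd hb h1 h2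
    obtain ⟨ε, hε, h | h⟩ := hside b hb.2 hb.1
    · obtain ⟨x, hx, hx'⟩ := exists_between (lt_min hbd (by linarith : b < b + ε))
      exact disjoint_left.1 hUV (h2 ⟨hx, hx'.trans_le (min_le_left _ _)⟩)
        (h.2 ⟨hx, hx'.trans_le (min_le_right _ _)⟩)
    · obtain ⟨x, hx, hx'⟩ := exists_between (max_lt hab (by linarith : b - ε < b))
      exact disjoint_left.1 hUV (h1 ⟨(le_max_left _ _).trans_lt hx, hx'⟩)
        (h.1 ⟨(le_max_right _ _).trans_lt hx, hx'⟩)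
  let Q : Set (ℝ × ℝ) := {p | p.1 ∈ B ∧ p.2 ∈ B ∧ p.1 < p.2 ∧ Ioo p.1 p.2 ⊆ U}
  have hQfin : Q.Finite := (hBfin.prod hBfin).subset fun p hp => ⟨hp.1, hp.2.1⟩
  have hQeq : ∀ p ∈ Q, ∀ q ∈ Q, p.1 ≤ q.1 → ∀ z ∈ Icc p.1 p.2, z ∈ Icc q.1 q.2 → p = q := by
    rintro p ⟨hp1, hp2, hp, hpU⟩ q ⟨hq1, hq2, hq, hqU⟩ hle z hzp hzq
    rcases hle.eq_or_lt with heq | hlt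
    · refine Prod.ext heq ?_
      rcases lt_trichotomy p.2 q.2 with h | h | h
      · exact absurd (hqU ⟨heq ▸ hp, h⟩) hp2.2
      · exact h
      · exact absurd (hpU ⟨heq ▸ hq, h⟩) hq2.2
    · exfalso
      rcases (hzq.1.trans hzp.2).eq_or_lt with h | h
      · exact htouch p.1 q.1 q.2 hlt hq hq1 (h ▸ hpU) hqU
      · exact hq1.2 (hpU ⟨hlt, h⟩)
  have hcover : ∀ y ∈ Vᶜ, ∃ p ∈ Q, y ∈ Icc p.1 p.2 := by
    intro y hy
    by_cases hyU : y ∈ U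
    · obtain ⟨a, ha, b, hb, hay, hyb, h⟩ := hbound y hyU
      exact ⟨(a, b), ⟨ha, hb, hay.trans hyb, h⟩, hay.le, hyb.le⟩
    obtain ⟨ε, hε, h | h⟩ := hside y hyU hy
    · have hx : y - ε / 2 ∈ Ioo (y - ε) y := ⟨by linarith, by linarith⟩
      obtain ⟨a, ha, b, hb, hax, hxb, hab⟩ := hbound _ (h.1 hx)
      refine ⟨(a, b), ⟨ha, hb, hax.trans hxb, hab⟩, (hax.trans hx.2).le, ?_⟩
      by_contra! hby
      exact hb.2 (h.1 ⟨hx.1.trans hxb, hby⟩)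
    · have hx : y + ε / 2 ∈ Ioo y (y + ε) := ⟨by linarith, by linarith⟩
      obtain ⟨a, ha, b, hb, hax, hxb, hab⟩ := hbound _ (h.2 hx)
      refine ⟨(a, b), ⟨ha, hb, hax.trans hxb, hab⟩, ?_, (hx.1.trans hxb).le⟩
      by_contra! hya
      exact ha.2 (h.2 ⟨hya, hax.trans hx.2⟩)
  have : Finite Q := hQfin
  obtain ⟨m, ⟨e⟩⟩ := Finite.exists_equiv_fin Q
  refine ⟨m, fun i => (e.symm i).1.1, fun i => (e.symm i).1.2, ?_, fun i => (e.symm i).2.2.2.1,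
    ?_, ?_, fun i => (e.symm i).2.1, fun i => (e.symm i).2.2.1, fun i => (e.symm i).2.2.2.2⟩
  · obtain ⟨y, hy⟩ := hne
    obtain ⟨p, hp, -⟩ := hcover y hy
    exact (e ⟨p, hp⟩).pos
  · refine Subset.antisymm (fun y hy => ?_) (iUnion_subset fun i y hy => ?_)
    · obtain ⟨p, hp, hyp⟩ := hcover y hy
      exact mem_iUnion.2 ⟨e ⟨p, hp⟩, by simpa using hyp⟩
    · obtain ⟨h1, h2, -, h⟩ := (e.symm i).2
      rcases hy.1.eq_or_lt with h' | h'
      · exact h' ▸ h1.1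
      rcases hy.2.eq_or_lt with h'' | h''
      · exact h'' ▸ h2.1
      · exact hUb (h ⟨h', h''⟩)
  · intro i j hij
    rw [disjoint_left]
    intro z hzi hzj
    refine hij (e.symm.injective (Subtype.ext ?_))
    rcases le_total (e.symm i).1.1 (e.symm j).1.1 with h | h
    · exact hQeq _ (e.symm i).2 _ (e.symm j).2 h z hzi hzj
    · exact (hQeq _ (e.symm j).2 _ (e.symm i).2 h z hzj hzi).symm

/-- If the vertical line t + iℝ meets the real-analytic simple closed boundary of a
bounded domain D transversely, then the slice K(t) = {y : t + iy ∈ D̄}, if nonempty,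
is a finite union of pairwise disjoint nondegenerate compact intervals whose
endpoints lie on bD and whose interiors lie in D. -/
theorem transversal_slice_is_finite_union_of_intervals
    (D : Set ℂ) (hDopen : IsOpen D) (hDconn : IsConnected D)
    (hDbdd : Bornology.IsBounded D)
    (γ : ℝ → ℂ) (hγan : ∀ s : ℝ, AnalyticAt ℝ γ s)
    (hγper : ∀ s : ℝ, γ (s + 2 * Real.pi) = γ s)
    (hγinj : Set.InjOn γ (Set.Ico 0 (2 * Real.pi)))
    (hγ' : ∀ s : ℝ, deriv γ s ≠ 0)
    (hγrange : Set.range γ = frontier D)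
    (t : ℝ)
    (htrans : ∀ s : ℝ, (γ s).re = t → (deriv γ s).re ≠ 0)
    (K : Set ℝ) (hK : K = {y : ℝ | (t : ℂ) + Complex.I * (y : ℂ) ∈ closure D})
    (hKne : K.Nonempty) :
    ∃ (m : ℕ) (y₁ y₂ : Fin m → ℝ), 0 < m ∧
      (∀ i, y₁ i < y₂ i) ∧
      K = ⋃ i, Set.Icc (y₁ i) (y₂ i) ∧
      (Pairwise fun i j => Disjoint (Set.Icc (y₁ i) (y₂ i)) (Set.Icc (y₁ j) (y₂ j))) ∧
      (∀ i, (t : ℂ) + Complex.I * (y₁ i : ℂ) ∈ frontier D) ∧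
      (∀ i, (t : ℂ) + Complex.I * (y₂ i : ℂ) ∈ frontier D) ∧
      (∀ i, ∀ y ∈ Set.Ioo (y₁ i) (y₂ i), (t : ℂ) + Complex.I * (y : ℂ) ∈ D) := by
  have hder : ∀ s, HasStrictDerivAt γ (deriv γ s) s := fun s => (hγan s).hasStrictDerivAt
  have hcont : Continuous γ := continuous_iff_continuousAt.2 fun s => (hγan s).continuousAt
  have hext := frontier_subset_closure_exterior hDopen hDconn.nonempty hDbdd hder hγ' hγper
    hγinj hγrange
  have hφ : Continuous fun y : ℝ => (t : ℂ) + I * (y : ℂ) := by fun_prop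
  let U : Set ℝ := (fun y : ℝ => (t : ℂ) + I * (y : ℂ)) ⁻¹' D
  let V : Set ℝ := (fun y : ℝ => (t : ℂ) + I * (y : ℂ)) ⁻¹' (closure D)ᶜ
  have hKV : K = Vᶜ := by
    rw [hK, ← preimage_compl, compl_compl]
    rfl
  have hDE : Disjoint D (closure D)ᶜ := disjoint_compl_right.mono_left subset_closure
  have hfr : Vᶜ \ U = (fun y : ℝ => (t : ℂ) + I * (y : ℂ)) ⁻¹' frontier D := by
    rw [hDopen.frontier_eq, ← preimage_compl, compl_compl, preimage_sdiff]
  have hbdd : Bornology.IsBounded Vᶜ := by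
    obtain ⟨R, hR⟩ := hDbdd.closure.exists_norm_le
    refine isBounded_iff_forall_norm_le.2 ⟨R, fun y hy => ?_⟩
    rw [← hKV, hK] at hy
    simpa using (abs_im_le_norm _).trans (hR _ hy)
  obtain ⟨m, y₁, y₂, hm, hlt, hcov, hdis, h1, h2, hin⟩ :=
    exists_finite_Icc_decomposition (U := U) (V := V) (hDopen.preimage hφ)
      (isClosed_closure.isOpen_compl.preimage hφ) (hDE.preimage _) hbdd (hKV ▸ hKne) (by
    intro b hbU hbV
    have hb : (t : ℂ) + I * (b : ℂ) ∈ frontier D := hfr.le ⟨hbV, hbU⟩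
    obtain ⟨s, hs⟩ : (t : ℂ) + I * (b : ℂ) ∈ range γ := hγrange ▸ hb
    have hv := htrans s (by simp [hs])
    obtain ⟨δ, hδ, h⟩ := exists_transverse_strip hDopen hcont hγper hγinj hγrange (hder s)
      (c := I) (by simpa using hv)
    have hsδ : s ∈ Ioo (s - δ) (s + δ) := ⟨by linarith, by linarith⟩
    have hline : ∀ y : ℝ, γ s + ((y - b : ℝ) : ℂ) * I = t + I * y := by
      intro y
      rw [hs]
      push_cast
      ring
    have hright : ∀ W : Set ℂ, (∀ s' ∈ Ioo (s - δ) (s + δ), ∀ u ∈ Ioo 0 δ, γ s' + u * I ∈ W) →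
        Ioo b (b + δ) ⊆ (fun y : ℝ => (t : ℂ) + I * (y : ℂ)) ⁻¹' W := fun W hW y hy => by
      have := hW s hsδ (y - b) ⟨by linarith [hy.1], by linarith [hy.2]⟩
      rwa [hline] at this
    have hleft : ∀ W : Set ℂ,
        (∀ s' ∈ Ioo (s - δ) (s + δ), ∀ u ∈ Ioo (-δ) 0, γ s' + u * I ∈ W) →
        Ioo (b - δ) b ⊆ (fun y : ℝ => (t : ℂ) + I * (y : ℂ)) ⁻¹' W := fun W hW y hy => by
      have := hW s hsδ (y - b) ⟨by linarith [hy.1], by linarith [hy.2]⟩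
      rwa [hline] at this
    refine ⟨δ, hδ, ?_⟩
    rcases h D (Or.inl rfl) (by rw [hs]; exact frontier_subset_closure hb) with hD | hD <;>
      rcases h _ (Or.inr rfl) (by rw [hs]; exact hext hb) with hE | hE
    · have hmid : δ / 2 ∈ Ioo 0 δ := ⟨by linarith, by linarith⟩
      exact absurd (hE s hsδ _ hmid) (disjoint_left.1 hDE (hD s hsδ _ hmid))
    · exact Or.inr ⟨hleft _ hE, hright _ hD⟩
    · exact Or.inl ⟨hleft _ hD, hright _ hE⟩
    · have hmid : -(δ / 2) ∈ Ioo (-δ) 0 := ⟨by linarith, by linarith⟩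
      exact absurd (hE s hsδ _ hmid) (disjoint_left.1 hDE (hD s hsδ _ hmid)))
  rw [hfr] at h1 h2
  exact ⟨m, y₁, y₂, hm, hlt, hKV.trans hcov, hdis, h1, h2, fun i y hy => hin i hy⟩
end

section
/- Let θ : ℂ → ℝ be continuous and set N = {(z, w) ∈ ℂ × ℂ : Re z = θ(w)}, P₁ = {(z, w) ∈ ℂ × ℂ : Re z > θ(w)}, P₂ = {(z, w) ∈ ℂ × ℂ : Re z < θ(w)}. Then P₁ and P₂ are nonempty, open, connected, disjoint, and (ℂ × ℂ) ∖ N = P₁ ∪ P₂; in particular, P₁ and P₂ are exactly the connected components of (ℂ × ℂ) ∖ N. -/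
open Complex Set

/-- Shearing by a continuous function `θ` preserves connectedness: the points whose first real
coordinate, measured relative to `θ`, lies in a convex set form a connected set. -/
theorem isConnected_setOf_re_sub_mem {θ : ℂ → ℝ} (hθ : Continuous θ) {S : Set ℝ}
    (hS : Convex ℝ S) (hne : S.Nonempty) :
    IsConnected {p : ℂ × ℂ | p.1.re - θ p.2 ∈ S} := by
  have hre : IsConnected (Complex.re ⁻¹' S) := by
    obtain ⟨x, hx⟩ := hne
    exact ⟨⟨x, by simpa using hx⟩, (hS.linear_preimage Complex.reLm).isPreconnected⟩
  have himage : {p : ℂ × ℂ | p.1.re - θ p.2 ∈ S} =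
      (fun p : ℂ × ℂ => (p.1 + (θ p.2 : ℂ), p.2)) '' ((Complex.re ⁻¹' S) ×ˢ univ) := by
    ext ⟨z, w⟩
    constructor
    · intro h
      exact ⟨(z - θ w, w), ⟨by simpa using h, mem_univ _⟩, by simp⟩
    · rintro ⟨⟨z', w'⟩, ⟨h, -⟩, heq⟩
      obtain ⟨rfl, rfl⟩ := Prod.mk.inj heq
      simpa using h
  rw [himage]
  exact (hre.prod isConnected_univ).image _ (by fun_prop)

/-- Each of two disjoint open sets, if connected, is a connected component of their union. -/
theorem connectedComponentIn_union_eq_left {X : Type*} [TopologicalSpace X] {U V : Set X}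
    (hU : IsOpen U) (hV : IsOpen V) (hUV : Disjoint U V) (hconn : IsPreconnected U)
    {x : X} (hx : x ∈ U) : connectedComponentIn (U ∪ V) x = U :=
  Subset.antisymm
    (isPreconnected_connectedComponentIn.subset_left_of_subset_union hU hV hUV
      (connectedComponentIn_subset _ _)
      ⟨x, mem_connectedComponentIn (Or.inl hx), hx⟩)
    (hconn.subset_connectedComponentIn hx subset_union_left)

/-- The complement of the "bent hypersurface" N = {Re z = θ(w)} in ℂ² has exactly
two connected components, P₁ = {Re z > θ(w)} and P₂ = {Re z < θ(w)}. -/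
theorem complement_of_graph_two_components
    (θ : ℂ → ℝ) (hθ : Continuous θ)
    (N : Set (ℂ × ℂ)) (hN : N = {p : ℂ × ℂ | p.1.re = θ p.2})
    (P₁ : Set (ℂ × ℂ)) (hP₁ : P₁ = {p : ℂ × ℂ | θ p.2 < p.1.re})
    (P₂ : Set (ℂ × ℂ)) (hP₂ : P₂ = {p : ℂ × ℂ | p.1.re < θ p.2}) :
    P₁.Nonempty ∧ P₂.Nonempty ∧ IsOpen P₁ ∧ IsOpen P₂ ∧
    IsConnected P₁ ∧ IsConnected P₂ ∧ Disjoint P₁ P₂ ∧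
    Nᶜ = P₁ ∪ P₂ ∧
    (∀ p ∈ P₁, connectedComponentIn Nᶜ p = P₁) ∧
    (∀ p ∈ P₂, connectedComponentIn Nᶜ p = P₂) := by
  have hc₁ : IsConnected P₁ := by
    simpa [hP₁] using isConnected_setOf_re_sub_mem hθ (convex_Ioi (0 : ℝ)) nonempty_Ioi
  have hc₂ : IsConnected P₂ := by
    simpa [hP₂] using isConnected_setOf_re_sub_mem hθ (convex_Iio (0 : ℝ)) nonempty_Iio
  have ho₁ : IsOpen P₁ := hP₁ ▸ isOpen_lt (by fun_prop) (by fun_prop)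
  have ho₂ : IsOpen P₂ := hP₂ ▸ isOpen_lt (by fun_prop) (by fun_prop)
  have hd : Disjoint P₁ P₂ := by
    subst hP₁ hP₂
    exact disjoint_left.2 fun p (h₁ : θ p.2 < p.1.re) (h₂ : p.1.re < θ p.2) => lt_asymm h₁ h₂
  have hcompl : Nᶜ = P₁ ∪ P₂ := by
    subst hN hP₁ hP₂
    ext p
    exact ne_iff_lt_or_gt.trans or_comm
  refine ⟨hc₁.nonempty, hc₂.nonempty, ho₁, ho₂, hc₁, hc₂, hd, hcompl, fun p hp => ?_,
    fun p hp => ?_⟩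
  · rw [hcompl]
    exact connectedComponentIn_union_eq_left ho₁ ho₂ hd hc₁.isPreconnected hp
  · rw [hcompl, union_comm]
    exact connectedComponentIn_union_eq_left ho₂ ho₁ hd.symm hc₂.isPreconnected hp
end

section
/- Let Ω ⊊ ℂ be a simply connected domain with 0 ∈ Ω which is symmetric with respect to the real axis, i.e. {conj ζ : ζ ∈ Ω} = Ω. Then there exists a biholomorphic map Φ from Ω onto the open unit disc Δ such that Φ(0) = 0 and Φ(conj ζ) = conj(Φ(ζ)) for all ζ ∈ Ω. -/
open Complex Set Metric

open Filter Topology ComplexConjugate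

/-- Pointwise convergence of holomorphic maps into the unit disc is locally uniform. -/
theorem tendstoLocallyUniformlyOn_of_mapsTo_ball {ι : Type*} {l : Filter ι} [l.NeBot]
    {U : Set ℂ} (hU : IsOpen U) {F : ι → ℂ → ℂ} {g : ℂ → ℂ}
    (hd : ∀ i, DifferentiableOn ℂ (F i) U) (hm : ∀ i, MapsTo (F i) U (ball 0 1))
    (hp : ∀ z ∈ U, Tendsto (fun i => F i z) l (𝓝 (g z))) :
    TendstoLocallyUniformlyOn F g l U := by
  rw [Metric.tendstoLocallyUniformlyOn_iff]
  intro ε hε x hx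
  obtain ⟨R, hR, hRU⟩ := Metric.isOpen_iff.1 hU x hx
  have lip : ∀ i, ∀ y ∈ ball x R, dist (F i y) (F i x) ≤ 2 / R * dist y x := fun i y hy => by
    refine dist_le_div_mul_dist_of_mapsTo_ball ((hd i).mono hRU) (fun w hw => ?_) hy
    have h1 := hm i (hRU hw)
    have h2 := hm i hx
    rw [mem_ball_zero_iff] at h1 h2
    rw [mem_closedBall, dist_eq_norm]
    linarith [norm_sub_le (F i w) (F i x)]
  have lip' : ∀ y ∈ ball x R, dist (g y) (g x) ≤ 2 / R * dist y x := fun y hy =>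
    le_of_tendsto ((hp y (hRU hy)).dist (hp x hx)) (.of_forall fun i => lip i y hy)
  have hδ : 0 < min R (ε * R / 8) := by positivity
  refine ⟨ball x (min R (ε * R / 8)), mem_nhdsWithin_of_mem_nhds (ball_mem_nhds x hδ), ?_⟩
  filter_upwards [Metric.tendsto_nhds.1 (hp x hx) (ε / 4) (by positivity)] with i hi y hy
  have hyR : y ∈ ball x R := ball_subset_ball (min_le_left _ _) hy
  have hyε : 2 / R * dist y x ≤ ε / 4 := by
    have : dist y x ≤ ε * R / 8 := (mem_ball.1 hy).le.trans (min_le_right _ _)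
    calc 2 / R * dist y x ≤ 2 / R * (ε * R / 8) := by gcongr
      _ = ε / 4 := by field_simp; norm_num
  have h1 := lip i y hyR
  have h2 := lip' y hyR
  have h4 := dist_triangle (g y) (g x) (F i x)
  have h5 := dist_triangle_right (g y) (F i y) (F i x)
  rw [dist_comm] at hi
  linarith

/-- A version of Hurwitz's theorem: near a zero of the locally uniform limit of holomorphic
functions, unless the limit vanishes identically there, the approximants have zeros. -/
theorem eventually_exists_zero_of_tendstoLocallyUniformlyOn {ι : Type*} {l : Filter ι} [l.NeBot]
    {U : Set ℂ} (hU : IsOpen U) {F : ι → ℂ → ℂ} {g : ℂ → ℂ}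
    (hd : ∀ i, DifferentiableOn ℂ (F i) U) (hF : TendstoLocallyUniformlyOn F g l U)
    {b : ℂ} (hb : b ∈ U) (hgb : g b = 0) (hg : ¬ ∀ᶠ z in 𝓝 b, g z = 0) {r : ℝ} (hr : 0 < r) :
    ∀ᶠ i in l, ∃ w ∈ U ∩ ball b r, F i w = 0 := by
  have hgd : DifferentiableOn ℂ g U := hF.differentiableOn (.of_forall hd) hU
  have hne := (hgd.analyticAt
    (hU.mem_nhds hb)).eventually_eq_zero_or_eventually_ne_zero.resolve_left hg
  rw [eventually_nhdsWithin_iff] at hne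
  obtain ⟨δ, hδ, hball⟩ := Metric.eventually_nhds_iff_ball.1 (hne.and (hU.mem_nhds hb))
  set ρ := min δ r / 2 with hρ
  have hρ0 : 0 < ρ := by positivity
  have hρδ : ρ < δ := by linarith [min_le_left δ r, lt_min hδ hr]
  have hρr : ρ < r := by linarith [min_le_right δ r, lt_min hδ hr]
  have hcU : closedBall b ρ ⊆ U := fun z hz => (hball z (closedBall_subset_ball hρδ hz)).2
  obtain ⟨z₀, hz₀, hmin⟩ := (isCompact_sphere b ρ).exists_isMinOn
    (NormedSpace.sphere_nonempty.2 hρ0.le)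
    ((hgd.continuousOn.mono (sphere_subset_closedBall.trans hcU)).norm)
  have hε : 0 < ‖g z₀‖ := by
    rw [norm_pos_iff]
    exact (hball z₀ (closedBall_subset_ball hρδ (sphere_subset_closedBall hz₀))).1
      (ne_of_mem_sphere hz₀ hρ0.ne')
  have huni := (tendstoLocallyUniformlyOn_iff_forall_isCompact hU).1 hF _ hcU
    (isCompact_closedBall b ρ)
  filter_upwards [Metric.tendstoUniformlyOn_iff.1 huni (‖g z₀‖ / 4) (by positivity)] with i hi
  have hib : ‖F i b‖ < ‖g z₀‖ / 4 := by
    simpa [hgb] using hi b (mem_closedBall_self hρ0.le)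
  have hsph : ∀ z ∈ sphere b ρ, ‖g z₀‖ / 2 ≤ ‖F i z - F i b‖ := fun z hz => by
    have h1 := hi z (sphere_subset_closedBall hz)
    have h2 : ‖g z₀‖ ≤ ‖g z‖ := hmin hz
    rw [dist_eq_norm] at h1
    have h3 := norm_sub_norm_le (g z) (g z - F i z)
    have h4 := norm_sub_norm_le (F i z) (F i b)
    rw [sub_sub_cancel] at h3
    linarith
  have hfreq : ∃ᶠ z in 𝓝 b, F i z ≠ F i b := by
    intro hev
    simp only [not_not] at hev
    have hbU : ball b δ ⊆ U := fun z hz => (hball z hz).2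
    have := (((hd i).mono hbU).analyticOnNhd isOpen_ball).eqOn_of_preconnected_of_eventuallyEq
      analyticOnNhd_const (convex_ball b δ).isPreconnected (mem_ball_self hδ) hev
    have h1 := hsph z₀ hz₀
    rw [this (closedBall_subset_ball hρδ (sphere_subset_closedBall hz₀))] at h1
    simp only [sub_self, norm_zero] at h1
    linarith
  have hdc : DiffContOnCl ℂ (F i) (ball b ρ) :=
    DifferentiableOn.diffContOnCl ((hd i).mono (closure_ball_subset_closedBall.trans hcU))
  obtain ⟨w, hw, hw0⟩ := hdc.ball_subset_image_closedBall hρ0 hsph hfreq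
    (show (0 : ℂ) ∈ _ by rw [mem_ball, dist_comm, dist_zero_right]; linarith)
  exact ⟨w, ⟨hcU hw, closedBall_subset_ball hρr hw⟩, hw0⟩

/-- Injective maps of `U` into the unit disc without critical points, sending `c` to `0`. -/
structure IsDiscEmbedding (U : Set ℂ) (c : ℂ) (f : ℂ → ℂ) : Prop where
  mapsTo : MapsTo f U (ball 0 1)
  injOn : InjOn f U
  deriv_ne_zero : ∀ z ∈ U, deriv f z ≠ 0
  map_base : f c = 0

theorem IsDiscEmbedding.differentiableOn {U : Set ℂ} {c : ℂ} {f : ℂ → ℂ}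
    (hf : IsDiscEmbedding U c f) : DifferentiableOn ℂ f U := fun z hz =>
  (differentiableAt_of_deriv_ne_zero (hf.deriv_ne_zero z hz)).differentiableWithinAt

/-- Among disc embeddings there is one with the largest derivative at the base point. -/
theorem exists_extremal_isDiscEmbedding {U : Set ℂ} (hU : IsOpen U) (hUc : IsPreconnected U)
    {c : ℂ} (hc : c ∈ U) {f₀ : ℂ → ℂ} (hf₀ : IsDiscEmbedding U c f₀) :
    ∃ g, IsDiscEmbedding U c g ∧
      ∀ f, IsDiscEmbedding U c f → ‖deriv f c‖ ≤ ‖deriv g c‖ := by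
  set S : Set ℝ := (fun f => ‖deriv f c‖) '' {f | IsDiscEmbedding U c f}
  have hbdd : BddAbove S := by
    obtain ⟨R, hR, hRU⟩ := Metric.isOpen_iff.1 hU c hc
    refine ⟨1 / R, ?_⟩
    rintro _ ⟨f, hf, rfl⟩
    refine norm_deriv_le_div_of_mapsTo_ball (hf.differentiableOn.mono hRU) ?_ hR
    rw [hf.map_base]
    exact fun z hz => ball_subset_closedBall (hf.mapsTo (hRU hz))
  obtain ⟨u, -, hu, huS⟩ := exists_seq_tendsto_sSup ⟨_, mem_image_of_mem _ hf₀⟩ hbdd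
  choose F hF hFu using huS
  let l : Ultrafilter ℕ := hyperfilter ℕ
  have hlim : ∀ z, ∃ w, z ∈ U → w ∈ closedBall (0 : ℂ) 1 ∧ Tendsto (fun n => F n z) l (𝓝 w) := by
    intro z
    by_cases hz : z ∈ U
    · obtain ⟨w, hw, hwl⟩ := (isCompact_closedBall (0 : ℂ) 1).ultrafilter_le_nhds'
        (l.map fun n => F n z)
        (Ultrafilter.mem_map.2 (univ_mem' fun n => ball_subset_closedBall ((hF n).mapsTo hz)))
      exact ⟨w, fun _ => ⟨hw, hwl⟩⟩
    · exact ⟨0, fun h => absurd h hz⟩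
  choose g hg using hlim
  have hFd : ∀ n, DifferentiableOn ℂ (F n) U := fun n => (hF n).differentiableOn
  have hconv : TendstoLocallyUniformlyOn F g l U :=
    tendstoLocallyUniformlyOn_of_mapsTo_ball hU hFd (fun n => (hF n).mapsTo) fun z hz => (hg z hz).2
  have hgd : DifferentiableOn ℂ g U := hconv.differentiableOn (.of_forall hFd) hU
  have hga : AnalyticOnNhd ℂ g U := hgd.analyticOnNhd hU
  have hconv' : TendstoLocallyUniformlyOn (fun n => deriv (F n)) (deriv g) l U :=
    hconv.deriv (.of_forall hFd) hU
  have hM : ‖deriv g c‖ = sSup S := by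
    refine tendsto_nhds_unique (hconv'.tendsto_at hc).norm ?_
    simp only [hFu]
    exact hu.mono_left Nat.hyperfilter_le_atTop
  have hext : ∀ f, IsDiscEmbedding U c f → ‖deriv f c‖ ≤ ‖deriv g c‖ := fun f hf =>
    hM ▸ le_csSup hbdd (mem_image_of_mem _ hf)
  have hgc : deriv g c ≠ 0 :=
    norm_pos_iff.1 ((norm_pos_iff.2 (hf₀.deriv_ne_zero c hc)).trans_le (hext _ hf₀))
  have hnc : ∀ w, ¬ EqOn g (fun _ => w) U := fun w h => by
    refine hgc ?_
    rw [(h.eventuallyEq_of_mem (hU.mem_nhds hc)).deriv_eq, deriv_const]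
  refine ⟨g, ⟨?_, ?_, ?_, ?_⟩, hext⟩
  · have hopen := (hga.is_constant_or_isOpen hUc).resolve_left (fun ⟨w, hw⟩ => hnc w hw) U
      subset_rfl hU
    have : g '' U ⊆ interior (closedBall 0 1) :=
      interior_maximal (image_subset_iff.2 fun z hz => (hg z hz).1) hopen
    rw [interior_closedBall _ one_ne_zero] at this
    exact mapsTo_iff_image_subset.2 this
  · intro a ha b hb hab
    by_contra hne
    have hev : ¬ ∀ᶠ z in 𝓝 b, g z - g a = 0 := fun h =>
      hnc (g a) (hga.eqOn_of_preconnected_of_eventuallyEq analyticOnNhd_const hUc hb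
        (h.mono fun z => sub_eq_zero.1))
    have hc' : TendstoLocallyUniformlyOn (fun n z => F n z - F n a) (fun z => g z - g a) l U :=
      hconv.sub (((hg a ha).2.tendstoUniformlyOn_const U).tendstoLocallyUniformlyOn)
    obtain ⟨n, w, hw, hw0⟩ := (eventually_exists_zero_of_tendstoLocallyUniformlyOn hU
      (fun n => (hFd n).sub_const _) hc' hb (by simp [hab]) hev (dist_pos.2 hne)).exists
    have := (hF n).injOn hw.1 ha (sub_eq_zero.1 hw0)
    subst this
    exact lt_irrefl _ (mem_ball.1 hw.2)
  · intro b hb hb0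
    have hev : ¬ ∀ᶠ z in 𝓝 b, deriv g z = 0 := fun h =>
      hgc (hga.deriv.eqOn_of_preconnected_of_eventuallyEq analyticOnNhd_const hUc hb h hc)
    obtain ⟨n, w, hw, hw0⟩ := (eventually_exists_zero_of_tendstoLocallyUniformlyOn hU
      (fun n => (hFd n).deriv hU) hconv' hb hb0 hev one_pos).exists
    exact (hF n).deriv_ne_zero w hw.1 hw0
  · refine tendsto_nhds_unique (hg c hc).2 ?_
    simp [(hF _).map_base]

/-- The automorphism of the unit disc sending `a` to `0`. -/
noncomputable def discMobius (a z : ℂ) : ℂ := (z - a) / (1 - conj a * z)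

section discMobius

variable {a z : ℂ}

theorem discMobius_denom_ne_zero (ha : ‖a‖ < 1) (hz : ‖z‖ < 1) : 1 - conj a * z ≠ 0 := by
  intro h
  have h1 : ‖conj a * z‖ = 1 := by rw [← sub_eq_zero.1 h, norm_one]
  rw [norm_mul, RCLike.norm_conj] at h1
  nlinarith [norm_nonneg a, norm_nonneg z]

@[simp] theorem discMobius_self : discMobius a a = 0 := by simp [discMobius]

theorem norm_discMobius_lt_one (ha : ‖a‖ < 1) (hz : ‖z‖ < 1) : ‖discMobius a z‖ < 1 := by
  rw [discMobius, norm_div, div_lt_one (norm_pos_iff.2 (discMobius_denom_ne_zero ha hz)),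
    ← sq_lt_sq₀ (norm_nonneg _) (norm_nonneg _), ← normSq_eq_norm_sq, ← normSq_eq_norm_sq]
  have ha2 : normSq a < 1 := by rw [normSq_eq_norm_sq]; nlinarith [norm_nonneg a]
  have hz2 : normSq z < 1 := by rw [normSq_eq_norm_sq]; nlinarith [norm_nonneg z]
  have h := mul_pos (sub_pos.2 ha2) (sub_pos.2 hz2)
  simp only [normSq_apply, sub_re, sub_im, mul_re, mul_im, conj_re, conj_im, one_re, one_im] at h ⊢
  nlinarith

theorem discMobius_neg_discMobius (ha : ‖a‖ < 1) (hz : ‖z‖ < 1) :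
    discMobius (-a) (discMobius a z) = z := by
  have h1 := discMobius_denom_ne_zero ha hz
  have h2 := discMobius_denom_ne_zero ha ha
  have h3 : 1 - conj a * z + conj a * (z - a) ≠ 0 := by
    convert h2 using 1; ring
  rw [discMobius, discMobius, map_neg, sub_neg_eq_add, neg_mul, sub_neg_eq_add, ← mul_div_assoc,
    div_add' _ _ _ h1, one_add_div h1, div_div_div_cancel_right₀ h1, div_eq_iff h3]
  ring

theorem discMobius_discMobius_neg (ha : ‖a‖ < 1) (hz : ‖z‖ < 1) :
    discMobius a (discMobius (-a) z) = z := by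
  simpa using discMobius_neg_discMobius (a := -a) (by simpa) hz

theorem discMobius_eq_zero_iff (ha : ‖a‖ < 1) (hz : ‖z‖ < 1) : discMobius a z = 0 ↔ z = a := by
  rw [discMobius, div_eq_zero_iff, or_iff_left (discMobius_denom_ne_zero ha hz), sub_eq_zero]

theorem injOn_discMobius (ha : ‖a‖ < 1) : InjOn (discMobius a) (ball 0 1) :=
  LeftInvOn.injOn (f₁' := discMobius (-a)) fun _ hz =>
    discMobius_neg_discMobius ha (mem_ball_zero_iff.1 hz)

theorem mapsTo_discMobius (ha : ‖a‖ < 1) : MapsTo (discMobius a) (ball 0 1) (ball 0 1) :=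
  fun _ hz => mem_ball_zero_iff.2 (norm_discMobius_lt_one ha (mem_ball_zero_iff.1 hz))

theorem differentiableAt_discMobius (ha : ‖a‖ < 1) (hz : ‖z‖ < 1) :
    DifferentiableAt ℂ (discMobius a) z :=
  DifferentiableAt.div (by fun_prop) (by fun_prop) (discMobius_denom_ne_zero ha hz)

theorem deriv_discMobius_ne_zero (ha : ‖a‖ < 1) (hz : ‖z‖ < 1) :
    deriv (discMobius a) z ≠ 0 := by
  have hev : discMobius (-a) ∘ discMobius a =ᶠ[𝓝 z] id := by
    filter_upwards [isOpen_ball.mem_nhds (mem_ball_zero_iff.2 hz)] with w hw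
    exact discMobius_neg_discMobius ha (mem_ball_zero_iff.1 hw)
  have h := hev.deriv_eq
  rw [deriv_comp z (differentiableAt_discMobius (by simpa) (norm_discMobius_lt_one ha hz))
    (differentiableAt_discMobius ha hz), deriv_id] at h
  exact right_ne_zero_of_mul_eq_one h

end discMobius

/-- A continuous square root of a nonvanishing holomorphic function is holomorphic. -/
theorem differentiableAt_of_sq_eq {f s : ℂ → ℂ} {z : ℂ} (hf : DifferentiableAt ℂ f z)
    (hs : ContinuousAt s z) (hsq : ∀ᶠ w in 𝓝 z, s w ^ 2 = f w) (hz : s z ≠ 0) :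
    DifferentiableAt ℂ s z := by
  have hsum : Tendsto (fun w => s w + s z) (𝓝[≠] z) (𝓝 (s z + s z)) :=
    (hs.tendsto.add_const _).mono_left nhdsWithin_le_nhds
  have h2 : s z + s z ≠ 0 := by simpa [← two_mul] using hz
  have hlim := (hasDerivAt_iff_tendsto_slope.1 hf.hasDerivAt).div hsum h2
  refine (hasDerivAt_iff_tendsto_slope.2 (hlim.congr' ?_)).differentiableAt
  filter_upwards [hsum.eventually_ne h2, hsq.filter_mono nhdsWithin_le_nhds] with w hw hw2
  rw [Pi.div_apply, slope_def_field, slope_def_field, ← hw2, ← hsq.self_of_nhds, div_right_comm]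
  congr 1
  rw [div_eq_iff hw]
  ring

open scoped Pointwise in
/-- A branch of the square root of `z - a`, with `a ∉ U`, is injective and omits a disc. -/
theorem exists_injective_not_dense_image {U : Set ℂ} (hU : IsOpen U)
    (hUs : IsSimplyConnected U) (hne : U ≠ univ) :
    ∃ f : ℂ → ℂ, Function.Injective f ∧ ¬Dense (f '' U) ∧ ∀ z ∈ U, deriv f z ≠ 0 := by
  wlog hU₀ : 0 ∉ U
  · rw [ne_univ_iff_exists_notMem] at hne
    rcases hne with ⟨a, ha⟩
    specialize this (hU.vadd (-a)) (by simpa) (by simp [hne])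
      (by simpa [mem_vadd_set_iff_neg_vadd_mem])
    rcases this with ⟨f, hf_inj, hf_dense, hdf⟩
    refine ⟨f ∘ (-a + ·), hf_inj.comp (add_right_injective (-a)), ?_, fun z hz ↦ ?_⟩
    · simpa only [← image_vadd, Set.image_image] using! hf_dense
    · simpa [Function.comp_def, deriv_comp_const_add] using hdf (-a + z) (mapsTo_image _ _ hz)
  rcases exists_continuousOn_pow_eq hUs hU continuousOn_id (by rwa [image_id]) two_ne_zero
    with ⟨f, hfc, hf_inv⟩
  replace hf_inv : Function.LeftInverse (· ^ 2) f := hf_inv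
  have hf₀ : ∀ z ∈ U, f z ≠ 0 := by
    intro z hz hfz
    simpa [hfz, (ne_of_mem_of_not_mem hz hU₀).symm] using hf_inv z
  have hdf : ∀ z ∈ U, HasStrictDerivAt f (2 * f z)⁻¹ z := by
    intro z hz
    apply HasStrictDerivAt.of_local_left_inverse
    · exact hfc.continuousAt <| hU.mem_nhds hz
    · simpa using hasStrictDerivAt_pow 2 (f z)
    · simpa using hf₀ z hz
    · exact .of_forall hf_inv
  refine ⟨f, hf_inv.injective, ?_, fun z hz ↦ ?_⟩
  · simp only [Dense, not_forall, mem_closure_iff_frequently, not_frequently]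
    rcases hUs.nonempty with ⟨x, hx⟩
    -- The image contains a neighbourhood of `f x`, hence omits a neighbourhood of `-f x`.
    use -f x
    have : f '' U ∈ 𝓝 (f x) := by
      rw [← (hdf x hx).map_nhds_eq (by simpa using hf₀ x hx)]
      exact Filter.image_mem_map <| hU.mem_nhds hx
    rw [nhds_neg, eventually_neg]
    filter_upwards [this]
    rintro _ ⟨a, ha, rfl⟩ ⟨b, hb, hab⟩
    obtain rfl : a = b := by
      rw [← hf_inv b, hab]
      simp [hf_inv a]
    refine hf₀ a ha ?_
    linear_combination hab / 2
  · simpa [(hdf z hz).hasDerivAt.deriv] using hf₀ z hz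

theorem exists_mapsTo_ball_injOn {U : Set ℂ} (hU : IsOpen U)
    (hUs : IsSimplyConnected U) (hne : U ≠ univ) :
    ∃ f : ℂ → ℂ, MapsTo f U (ball 0 1) ∧ InjOn f U ∧ ∀ z ∈ U, deriv f z ≠ 0 := by
  rcases exists_injective_not_dense_image hU hUs hne with ⟨f, hf_inj, hfd, hdf⟩
  obtain ⟨x, ε, hε₀, hε⟩ : ∃ (x : ℂ) (ε : ℝ), 0 < ε ∧ ∀ a ∈ U, ε < dist (f a) x := by
    simpa [Dense, mem_closure_iff_nhds_basis Metric.nhds_basis_closedBall] using hfd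
  have hfx : ∀ z ∈ U, f z ≠ x := fun z hz ↦ by simpa using hε₀.trans (hε z hz)
  refine ⟨fun z ↦ ε / (f z - x), fun z hz => ?_, fun z hz w hw heq => ?_, fun z hz => ?_⟩
  · rw [mem_ball_zero_iff, norm_div, norm_real, Real.norm_of_nonneg hε₀.le, div_lt_one₀]
    · simpa [dist_eq_norm] using hε z hz
    · simpa [sub_eq_zero] using hfx z hz
  · simpa [div_eq_mul_inv, hε₀.ne', hf_inj.eq_iff] using heq
  · have hdz : DifferentiableAt ℂ f z := differentiableAt_of_deriv_ne_zero (hdf z hz)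
    rw [(hasDerivAt_const _ _).fun_div (hdz.hasDerivAt.sub_const _) _ |>.deriv] <;>
      simp [*, ne_of_gt, sub_eq_zero]

theorem exists_isDiscEmbedding {U : Set ℂ} (hU : IsOpen U) (hUs : IsSimplyConnected U)
    (hne : U ≠ univ) {c : ℂ} (hc : c ∈ U) : ∃ f, IsDiscEmbedding U c f := by
  obtain ⟨f, hm, hi, hd⟩ := exists_mapsTo_ball_injOn hU hUs hne
  have hlt : ∀ z ∈ U, ‖f z‖ < 1 := fun z hz => mem_ball_zero_iff.1 (hm hz)
  refine ⟨discMobius (f c) ∘ f, (mapsTo_discMobius (hlt c hc)).comp hm,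
    (injOn_discMobius (hlt c hc)).comp hi hm, fun z hz => ?_, discMobius_self⟩
  rw [deriv_comp z (differentiableAt_discMobius (hlt c hc) (hlt z hz))
    (differentiableAt_of_deriv_ne_zero (hd z hz))]
  exact mul_ne_zero (deriv_discMobius_ne_zero (hlt c hc) (hlt z hz)) (hd z hz)

/-- The map that undoes a disc automorphism, a square root and another disc automorphism is a
strict contraction at the origin. -/
theorem norm_deriv_discMobius_sq_lt_one {a b : ℂ} (ha : ‖a‖ < 1) (hb : ‖b‖ < 1)
    (h0 : discMobius a (discMobius b 0 ^ 2) = 0) :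
    DifferentiableOn ℂ (fun z => discMobius a (discMobius b z ^ 2)) (ball 0 1) ∧
      ‖deriv (fun z => discMobius a (discMobius b z ^ 2)) 0‖ < 1 := by
  set P : ℂ → ℂ := fun z => discMobius a (discMobius b z ^ 2) with hP
  have hP0 : P 0 = 0 := h0
  have hsq : ∀ z ∈ ball (0 : ℂ) 1, ‖discMobius b z ^ 2‖ < 1 := fun z hz => by
    rw [norm_pow]
    exact pow_lt_one₀ (norm_nonneg _) (norm_discMobius_lt_one hb (mem_ball_zero_iff.1 hz)) two_ne_zero
  have hPd : DifferentiableOn ℂ P (ball 0 1) := fun z hz =>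
    (DifferentiableAt.comp z (differentiableAt_discMobius ha (hsq z hz))
      ((differentiableAt_discMobius hb (mem_ball_zero_iff.1 hz)).pow 2)).differentiableWithinAt
  have hPm : MapsTo P (ball 0 1) (closedBall (P 0) 1) := fun z hz => by
    rw [hP0]
    exact ball_subset_closedBall (mem_ball_zero_iff.2 (norm_discMobius_lt_one ha (hsq z hz)))
  refine ⟨hPd, (norm_deriv_le_one_of_mapsTo_ball hPd hPm one_pos).lt_of_ne fun h1 => ?_⟩
  have haff := affine_of_mapsTo_ball_of_norm_dslope_eq_div hPd hPm (mem_ball_self one_pos)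
    (by rw [dslope_same, h1, div_one])
  simp only [dslope_same, sub_zero, hP0, zero_add, smul_eq_mul] at haff
  have hP' : deriv P 0 ≠ 0 := norm_pos_iff.1 (h1 ▸ one_pos)
  have hnb : ‖-b‖ < 1 := by simpa
  have ht : ‖(1 / 2 : ℂ)‖ < 1 := by norm_num
  have ht' : ‖(-(1 / 2) : ℂ)‖ < 1 := by norm_num
  have hmem : ∀ t : ℂ, ‖t‖ < 1 → discMobius (-b) t ∈ ball (0 : ℂ) 1 := fun t h =>
    mem_ball_zero_iff.2 (norm_discMobius_lt_one hnb h)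
  have heq : P (discMobius (-b) (1 / 2)) = P (discMobius (-b) (-(1 / 2))) := by
    simp only [hP, discMobius_discMobius_neg hb ht, discMobius_discMobius_neg hb ht', neg_sq]
  rw [haff (hmem _ ht), haff (hmem _ ht')] at heq
  beta_reduce at heq
  have := injOn_discMobius hnb (mem_ball_zero_iff.2 ht) (mem_ball_zero_iff.2 ht')
    (mul_right_cancel₀ hP' heq)
  norm_num at this

theorem surjOn_of_extremal {U : Set ℂ} (hU : IsOpen U) (hUs : IsSimplyConnected U) {c : ℂ}
    (hc : c ∈ U) {f : ℂ → ℂ} (hf : IsDiscEmbedding U c f)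
    (hext : ∀ g, IsDiscEmbedding U c g → ‖deriv g c‖ ≤ ‖deriv f c‖) :
    SurjOn f U (ball 0 1) := by
  intro a ha'
  have ha : ‖a‖ < 1 := mem_ball_zero_iff.1 ha'
  by_contra hna
  have hlt : ∀ z ∈ U, ‖f z‖ < 1 := fun z hz => mem_ball_zero_iff.1 (hf.mapsTo hz)
  have hfd : ∀ z ∈ U, DifferentiableAt ℂ f z := fun z hz =>
    differentiableAt_of_deriv_ne_zero (hf.deriv_ne_zero z hz)
  have hψd : ∀ z ∈ U, DifferentiableAt ℂ (fun z => discMobius a (f z)) z := fun z hz =>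
    (differentiableAt_discMobius ha (hlt z hz)).comp z (hfd z hz)
  have hψ0 : ∀ z ∈ U, discMobius a (f z) ≠ 0 := fun z hz h =>
    hna ⟨z, hz, (discMobius_eq_zero_iff ha (hlt z hz)).1 h⟩
  obtain ⟨s, hsc, hs⟩ := exists_continuousOn_pow_eq hUs hU
    (fun z hz => (hψd z hz).continuousAt.continuousWithinAt)
    (by rintro ⟨z, hz, h⟩; exact hψ0 z hz h) two_ne_zero
  have hs0 : ∀ z ∈ U, s z ≠ 0 := fun z hz h => hψ0 z hz (by simp [← hs z, h])
  have hsd : ∀ z ∈ U, DifferentiableAt ℂ s z := fun z hz =>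
    differentiableAt_of_sq_eq (hψd z hz) (hsc.continuousAt (hU.mem_nhds hz)) (.of_forall hs)
      (hs0 z hz)
  have hslt : ∀ z ∈ U, ‖s z‖ < 1 := fun z hz => by
    rw [← pow_lt_one_iff_of_nonneg (norm_nonneg _) two_ne_zero, ← norm_pow, hs z]
    exact norm_discMobius_lt_one ha (hlt z hz)
  set b := s c
  have hb : ‖b‖ < 1 := hslt c hc
  have hna' : ‖-a‖ < 1 := by simpa
  have hnb : ‖-b‖ < 1 := by simpa
  set G : ℂ → ℂ := fun z => discMobius b (s z)
  set P : ℂ → ℂ := fun z => discMobius (-a) (discMobius (-b) z ^ 2) with hP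
  have hPG : ∀ z ∈ U, P (G z) = f z := fun z hz => by
    simp only [hP, G, discMobius_neg_discMobius hb (hslt z hz), hs z,
      discMobius_neg_discMobius ha (hlt z hz)]
  have hGc : G c = 0 := discMobius_self
  have hP0 : P 0 = 0 := by
    have := hPG c hc
    rwa [hGc, hf.map_base] at this
  obtain ⟨hPd, hPlt⟩ := norm_deriv_discMobius_sq_lt_one hna' hnb hP0
  have hGm : MapsTo G U (ball 0 1) := fun z hz =>
    mem_ball_zero_iff.2 (norm_discMobius_lt_one hb (hslt z hz))
  have hchain : ∀ z ∈ U, deriv f z = deriv P (G z) * deriv G z := fun z hz => by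
    rw [← deriv_comp z (hPd.differentiableAt (isOpen_ball.mem_nhds (hGm hz)))
      ((differentiableAt_discMobius hb (hslt z hz)).comp z (hsd z hz))]
    refine EventuallyEq.deriv_eq ?_
    filter_upwards [hU.mem_nhds hz] with w hw using (hPG w hw).symm
  have hG : IsDiscEmbedding U c G := by
    refine ⟨hGm, fun z hz w hw h => hf.injOn hz hw ?_, fun z hz h => hf.deriv_ne_zero z hz ?_, hGc⟩
    · rw [← hPG z hz, ← hPG w hw, h]
    · rw [hchain z hz, h, mul_zero]
  have hle := hext G hG
  rw [hchain c hc, hGc, norm_mul] at hle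
  nlinarith [norm_pos_iff.2 (hG.deriv_ne_zero c hc)]

/-- The **Riemann mapping theorem**. -/
theorem exists_isDiscEmbedding_bijOn {U : Set ℂ} (hU : IsOpen U) (hUs : IsSimplyConnected U)
    (hne : U ≠ univ) {c : ℂ} (hc : c ∈ U) :
    ∃ f, IsDiscEmbedding U c f ∧ BijOn f U (ball 0 1) := by
  obtain ⟨f₀, hf₀⟩ := exists_isDiscEmbedding hU hUs hne hc
  obtain ⟨f, hf, hext⟩ := exists_extremal_isDiscEmbedding hU
    hUs.isPathConnected.isConnected.isPreconnected hc hf₀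
  exact ⟨f, hf, hf.mapsTo, hf.injOn, surjOn_of_extremal hU hUs hc hf hext⟩

/-- A Riemann map is determined by its derivative at the base point. -/
theorem IsDiscEmbedding.eqOn_of_deriv_eq {U : Set ℂ} (hU : IsOpen U) {c : ℂ} (hc : c ∈ U)
    {f g : ℂ → ℂ} (hf : IsDiscEmbedding U c f) (hfs : SurjOn f U (ball 0 1))
    (hgd : DifferentiableOn ℂ g U) (hgm : MapsTo g U (ball 0 1)) (hgc : g c = 0)
    (h : deriv g c = deriv f c) : EqOn g f U := by
  set k := Function.invFunOn f U
  have hk : ∀ z ∈ U, k (f z) = z := hf.injOn.leftInvOn_invFunOn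
  have hkd : ∀ z ∈ U, DifferentiableAt ℂ k (f z) := fun z hz => by
    have hstr : HasStrictDerivAt f (deriv f z) z :=
      (hf.differentiableOn.analyticAt (hU.mem_nhds hz)).hasStrictDerivAt
    have hloc := (hstr.hasStrictFDerivAt_equiv (hf.deriv_ne_zero z hz)).localInverse_unique
      (g := k) (by filter_upwards [hU.mem_nhds hz] using hk)
    exact (hstr.to_localInverse
      (hf.deriv_ne_zero z hz)).hasDerivAt.differentiableAt.congr_of_eventuallyEq hloc
  set H := g ∘ k
  have hHf : ∀ z ∈ U, H (f z) = g z := fun z hz => by simp [H, hk z hz]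
  have hHd : DifferentiableOn ℂ H (ball 0 1) := by
    intro w hw
    obtain ⟨z, hz, rfl⟩ := hfs hw
    refine (DifferentiableAt.comp (f z) ?_ (hkd z hz)).differentiableWithinAt
    rw [hk z hz]
    exact hgd.differentiableAt (hU.mem_nhds hz)
  have hH0 : H 0 = 0 := by
    have := hHf c hc
    rwa [hf.map_base, hgc] at this
  have hHm : MapsTo H (ball 0 1) (closedBall (H 0) 1) := by
    intro w hw
    obtain ⟨z, hz, rfl⟩ := hfs hw
    rw [hH0, hHf z hz]
    exact ball_subset_closedBall (hgm hz)
  have hfc : DifferentiableAt ℂ f c := differentiableAt_of_deriv_ne_zero (hf.deriv_ne_zero c hc)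
  have hH1 : deriv H 0 = 1 := by
    have hev : H ∘ f =ᶠ[𝓝 c] g := by filter_upwards [hU.mem_nhds hc] using hHf
    have hd := hev.deriv_eq
    rw [deriv_comp c _ hfc, h, hf.map_base] at hd
    · exact mul_eq_right₀ (hf.deriv_ne_zero c hc) |>.1 hd
    · rw [hf.map_base]
      exact hHd.differentiableAt (ball_mem_nhds 0 one_pos)
  have haff := affine_of_mapsTo_ball_of_norm_dslope_eq_div hHd hHm (mem_ball_self one_pos)
    (by rw [dslope_same, hH1, norm_one, div_one])
  simp only [dslope_same, hH1, hH0, sub_zero, zero_add, smul_eq_mul, mul_one] at haff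
  intro z hz
  rw [← hHf z hz, haff (hf.mapsTo hz)]

/-- A symmetric version of the Riemann mapping theorem: a proper simply connected
domain Ω ∋ 0 symmetric with respect to the real axis admits a biholomorphism Φ
onto the unit disc with Φ(0) = 0 and Φ(conj ζ) = conj(Φ(ζ)). -/
theorem symmetric_riemann_map
    (Ω : Set ℂ) (hΩopen : IsOpen Ω) (hΩconn : IsConnected Ω)
    (hΩne : Ω ≠ Set.univ) (h0 : (0 : ℂ) ∈ Ω)
    (hΩsc : SimplyConnectedSpace ↥Ω)
    (hsym : (fun ζ => (starRingEnd ℂ) ζ) '' Ω = Ω) :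
    ∃ Φ : ℂ → ℂ, DifferentiableOn ℂ Φ Ω ∧
      Set.BijOn Φ Ω (Metric.ball (0 : ℂ) 1) ∧
      Φ 0 = 0 ∧
      ∀ ζ ∈ Ω, Φ ((starRingEnd ℂ) ζ) = (starRingEnd ℂ) (Φ ζ) := by
  obtain ⟨f, hf, hfb⟩ := exists_isDiscEmbedding_bijOn hΩopen hΩsc hΩne h0
  have hconj : ∀ z ∈ Ω, conj z ∈ Ω := fun z hz => hsym ▸ mem_image_of_mem _ hz
  have hd0 := hf.deriv_ne_zero 0 h0
  -- Rotate so that the derivative at the origin becomes real.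
  set u : ℂ := conj (deriv f 0) / ‖deriv f 0‖
  have hu : ‖u‖ = 1 := by
    simp [u, hd0]
  have hu0 : u ≠ 0 := norm_pos_iff.1 (hu ▸ one_pos)
  set Φ : ℂ → ℂ := fun z => u * f z
  have hΦd : ∀ z, deriv Φ z = u * deriv f z := fun z => deriv_const_mul_field u
  have hΦ : IsDiscEmbedding Ω 0 Φ := by
    refine ⟨fun z hz => ?_, fun z hz w hw h => hf.injOn hz hw (mul_left_cancel₀ hu0 h),
      fun z hz => ?_, by simp [Φ, hf.map_base]⟩
    · simpa [Φ, hu] using hf.mapsTo hz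
    · rw [hΦd]
      exact mul_ne_zero hu0 (hf.deriv_ne_zero z hz)
  have hΦs : SurjOn Φ Ω (ball 0 1) := by
    intro w hw
    obtain ⟨z, hz, hzw⟩ := hfb.surjOn (show u⁻¹ * w ∈ ball (0 : ℂ) 1 by simpa [hu] using hw)
    exact ⟨z, hz, by simp [Φ, hzw, hu0]⟩
  have hreal : conj (deriv Φ 0) = deriv Φ 0 := by
    simp only [hΦd, u, map_mul, map_div₀, conj_conj, conj_ofReal]
    ring
  have hΨ : EqOn (conj ∘ Φ ∘ conj) Φ Ω := by
    refine hΦ.eqOn_of_deriv_eq hΩopen h0 hΦs (fun z hz => ?_) (fun z hz => ?_) ?_ ?_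
    · exact (differentiableAt_conj_conj_iff.2
        (hΦ.differentiableOn.differentiableAt
          (hΩopen.mem_nhds (hconj z hz)))).differentiableWithinAt
    · simpa using hΦ.mapsTo (hconj z hz)
    · simp [hΦ.map_base]
    · rw [deriv_conj_conj, Function.comp_apply, Function.comp_apply, map_zero, hreal]
  refine ⟨Φ, hΦ.differentiableOn, ⟨hΦ.mapsTo, hΦ.injOn, hΦs⟩, hΦ.map_base, fun z hz => ?_⟩
  rw [← hΨ hz]
  simp
end
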